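/- Under Assumption 1 there exists a constant c > 0, depending only on B, M and a, such that for all j ∈ ℕ and all θ ∈ [0, π], |∑_{ℓ≥0} b_{j,ℓ} L_ℓ(cos θ)| ≤ c B^{2j}/(1 + B^j θ)^M. Consequently, if (ξ_{j,k}, λ_{j,k})_{1≤k≤N_j} is a pixelization of order 4B^{j+1} with constant c₀ and ψ_{j,k}(ξ) = √λ_{j,k} ∑_{ℓ≥0} b_{j,ℓ} L_ℓ(ξ·ξ_{j,k}) is the needlet, then |ψ_{j,k}(ξ)| ≤ c' B^j/(1 + B^j d(ξ, ξ_{j,k}))^M for all ξ ∈ S², with c' depending only on B, M, a and c₀. -/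

import Mathlib

open MeasureTheory Real Filter Asymptotics ProbabilityTheory
open scoped BigOperators ENNReal NNReal RealInnerProductSpace Classical

noncomputable section

/-- Euclidean space `ℝ³`. -/
abbrev E3 : Type := EuclideanSpace ℝ (Fin 3)

/-- Geodesic distance on the unit sphere `S² ⊆ ℝ³`. -/
noncomputable def gd (x y : E3) : ℝ := Real.arccos ⟪x, y⟫

/-- Legendre polynomial of degree `l` (Rodrigues' formula). -/
noncomputable def legP (l : ℕ) (x : ℝ) : ℝ :=
  ((2 : ℝ) ^ l * (Nat.factorial l : ℝ))⁻¹ *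
    iteratedDeriv l (fun t : ℝ => (t ^ 2 - 1) ^ l) x

/-- Normalized Legendre kernel `L_ℓ = ((2ℓ+1)/(4π)) P_ℓ`. -/
noncomputable def legL (l : ℕ) (x : ℝ) : ℝ := ((2 * l + 1) / (4 * Real.pi)) * legP l x

/-- `μ` is the rotation-invariant surface measure on `S²` with total mass `4π`. -/
def IsSphereMeasure (μ : MeasureTheory.Measure E3) : Prop :=
  (∀ ρ : E3 ≃ₗᵢ[ℝ] E3, μ.map ρ = μ) ∧
    μ (Metric.sphere (0 : E3) 1)ᶜ = 0 ∧ μ Set.univ = ENNReal.ofReal (4 * Real.pi)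

/-- A pixelization of order `L` with constant `c₀`: cubature points `ξ` on the sphere and
positive weights `w` satisfying properties (1a)–(1e). -/
structure IsPixelization (μ : MeasureTheory.Measure E3) (c₀ L : ℝ) {N : ℕ}
    (ξ : Fin N → E3) (w : Fin N → ℝ) : Prop where
  sphere : ∀ k, ‖ξ k‖ = 1
  wpos : ∀ k, 0 < w k
  cubature : ∀ p : MvPolynomial (Fin 3) ℝ, (p.totalDegree : ℝ) ≤ L →
    ∑ k, w k * MvPolynomial.eval (fun i => ξ k i) p
      = ∫ x, MvPolynomial.eval (fun i => x i) p ∂μ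
  card_low : c₀⁻¹ * L ^ 2 ≤ (N : ℝ)
  card_high : (N : ℝ) ≤ c₀ * L ^ 2
  w_low : ∀ k, c₀⁻¹ * (L ^ 2)⁻¹ ≤ w k
  w_high : ∀ k, w k ≤ c₀ * (L ^ 2)⁻¹
  covering : ∀ x : E3, ‖x‖ = 1 → ∃ k, gd x (ξ k) ≤ c₀ * L⁻¹
  separation : ∀ k k' : Fin N, k ≠ k' → c₀⁻¹ * L⁻¹ ≤ gd (ξ k) (ξ k')

/-- Assumption 1: the function `a` generating the `B`-adic window. -/
structure IsWindow (B : ℝ) (M : ℕ) (a : ℝ → ℝ) : Prop where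
  oneLt : 1 < B
  Mge : 3 ≤ M
  smooth : ContDiff ℝ M a
  suppB : ∀ x : ℝ, B < |x| → a x = 0
  oneOn : ∀ x : ℝ, |x| ≤ B⁻¹ → a x = 1

/-- `b(x) = a(x/B) − a(x)`. -/
noncomputable def bW (B : ℝ) (a : ℝ → ℝ) (x : ℝ) : ℝ := a (x / B) - a x

/-- `b_{j,ℓ} = b(B^{−j} ℓ)`. -/
noncomputable def bjl (B : ℝ) (a : ℝ → ℝ) (j l : ℕ) : ℝ := bW B a ((l : ℝ) / B ^ j)

/-- The needlet kernel `Ψ_j(t) = ∑_ℓ b_{j,ℓ} L_ℓ(t)`. -/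
noncomputable def psiSum (B : ℝ) (a : ℝ → ℝ) (j : ℕ) (t : ℝ) : ℝ :=
  ∑' l : ℕ, bjl B a j l * legL l t

/-- The band-averaged power spectrum `C^{(j)} = (4π)⁻¹ ∑_ℓ (2ℓ+1) b_{j,ℓ}² C_ℓ`. -/
noncomputable def Cband (B : ℝ) (a : ℝ → ℝ) (C : ℕ → ℝ) (j : ℕ) : ℝ :=
  (4 * Real.pi)⁻¹ * ∑' l : ℕ, (2 * l + 1) * (bjl B a j l) ^ 2 * C l

/-- Assumption 2: regularity of the power spectrum `C_ℓ = ℓ^{−α} g_j(B^{−j}ℓ)`. -/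
structure IsSpectrum (B : ℝ) (M : ℕ) (α : ℝ) (C : ℕ → ℝ) (g : ℕ → ℝ → ℝ) (d : ℕ → ℝ) :
    Prop where
  alpha_gt : 2 < α
  nonneg : ∀ l, 0 ≤ C l
  smooth : ∀ j, ContDiff ℝ M (g j)
  eq : ∀ j l : ℕ, B ^ j / B ≤ (l : ℝ) → (l : ℝ) ≤ B ^ j * B →
    C l = (l : ℝ) ^ (-α) * g j ((l : ℝ) / B ^ j)
  dpos : ∀ r, r ≤ M → 0 < d r
  g_low : ∀ j, ∀ u ∈ Set.Icc B⁻¹ B, (d 0)⁻¹ ≤ g j u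
  g_high : ∀ j, ∀ u ∈ Set.Icc B⁻¹ B, g j u ≤ d 0
  deriv_bound : ∀ j r, 1 ≤ r → r ≤ M → ∀ u ∈ Set.Icc B⁻¹ B,
    |iteratedDeriv r (g j) u| ≤ d r

/-- The antiderivative power `(x² - 1)ⁿ / (2ⁿ n!)` of Rodrigues' formula. -/
def rodrigues (n : ℕ) : Polynomial ℝ :=
  Polynomial.C (((2 : ℝ) ^ n * (n.factorial : ℝ))⁻¹) * (Polynomial.X ^ 2 - 1) ^ n

lemma iteratedDeriv_polynomial_eval (p : Polynomial ℝ) (n : ℕ) :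
    iteratedDeriv n (fun x => p.eval x) = fun x => (Polynomial.derivative^[n] p).eval x := by
  induction n generalizing p with
  | zero => simp
  | succ n ih =>
    rw [iteratedDeriv_succ', Function.iterate_succ_apply, ← ih]
    congr 1
    ext x
    exact p.deriv

lemma legP_eq_eval (n : ℕ) (x : ℝ) :
    legP n x = (Polynomial.derivative^[n] (rodrigues n)).eval x := by
  have h : (fun t : ℝ => (t ^ 2 - 1) ^ n) =
      fun t => ((Polynomial.X ^ 2 - 1 : Polynomial ℝ) ^ n).eval t := by
    ext t; simp
  rw [legP, h, iteratedDeriv_polynomial_eval, rodrigues, Polynomial.iterate_derivative_C_mul]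
  simp

lemma derivative_rodrigues_succ (n : ℕ) :
    Polynomial.derivative (rodrigues (n + 1)) = Polynomial.X * rodrigues n := by
  have h : ((2 : ℝ) ^ (n + 1) * ((n + 1).factorial : ℝ))⁻¹ * ((n + 1) * 2) =
      ((2 : ℝ) ^ n * (n.factorial : ℝ))⁻¹ := by
    rw [Nat.factorial_succ, pow_succ]
    push_cast
    field_simp
  rw [rodrigues, rodrigues, ← h]
  simp only [Polynomial.derivative_C_mul, Polynomial.derivative_pow_succ,
    Polynomial.derivative_sub, Polynomial.derivative_one, Polynomial.C_mul, Polynomial.C_add,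
    Polynomial.C_1]
  simp [show Polynomial.C (2 : ℝ) = 2 from map_ofNat Polynomial.C 2]
  ring

lemma rodrigues_succ (n : ℕ) :
    Polynomial.C (2 * ((n : ℝ) + 1)) * rodrigues (n + 1) =
      (Polynomial.X ^ 2 - 1) * rodrigues n := by
  have h : 2 * ((n : ℝ) + 1) * ((2 : ℝ) ^ (n + 1) * ((n + 1).factorial : ℝ))⁻¹ =
      ((2 : ℝ) ^ n * (n.factorial : ℝ))⁻¹ := by
    rw [Nat.factorial_succ, pow_succ]
    push_cast
    field_simp
  rw [rodrigues, rodrigues, ← h, Polynomial.C_mul (a := 2 * ((n : ℝ) + 1))]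
  ring

lemma derivative_two_rodrigues (n : ℕ) :
    Polynomial.derivative (Polynomial.derivative (rodrigues (n + 2))) =
      Polynomial.C (2 * (n : ℝ) + 3) * rodrigues (n + 1) + rodrigues n := by
  rw [derivative_rodrigues_succ, Polynomial.derivative_mul, derivative_rodrigues_succ,
    Polynomial.derivative_X]
  have h := rodrigues_succ n
  have h' : Polynomial.C (2 * (n : ℝ) + 3) = Polynomial.C (2 * ((n : ℝ) + 1)) + 1 := by
    rw [← Polynomial.C_1, ← Polynomial.C_add]
    ring_nf
  rw [h']
  linear_combination -h

/-- Bonnet's three-term recurrence. -/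
lemma legP_add_two (n : ℕ) (x : ℝ) :
    (n + 2) * legP (n + 2) x = (2 * n + 3) * x * legP (n + 1) x - (n + 1) * legP n x := by
  have hA : legP (n + 2) x = x * legP (n + 1) x +
      (n + 1) * (Polynomial.derivative^[n] (rodrigues (n + 1))).eval x := by
    rw [legP_eq_eval, legP_eq_eval, Function.iterate_succ_apply, derivative_rodrigues_succ,
      mul_comm, Polynomial.iterate_derivative_mul_X]
    simp [mul_comm]
  have hB : legP (n + 2) x =
      (2 * n + 3) * (Polynomial.derivative^[n] (rodrigues (n + 1))).eval x + legP n x := by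
    rw [legP_eq_eval, legP_eq_eval, Function.iterate_succ_apply, Function.iterate_succ_apply,
      derivative_two_rodrigues, iterate_map_add,
      Polynomial.iterate_derivative_C_mul]
    simp
  linear_combination (2 * (n : ℝ) + 3) * hA - (n + 1) * hB

/-- The Taylor coefficients `(2n choose n) / 4ⁿ` of `(1 - t)^(-1/2)`. -/
def invSqrtCoeff (n : ℕ) : ℝ := n.centralBinom / 4 ^ n

lemma invSqrtCoeff_pos (n : ℕ) : 0 < invSqrtCoeff n := by
  have := n.centralBinom_pos
  unfold invSqrtCoeff
  positivity

lemma invSqrtCoeff_succ (n : ℕ) :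
    (n + 1) * invSqrtCoeff (n + 1) = (n + 1 / 2) * invSqrtCoeff n := by
  have h : ((n : ℝ) + 1) * (n + 1).centralBinom = 2 * (2 * n + 1) * n.centralBinom := by
    exact_mod_cast n.succ_mul_centralBinom_succ
  unfold invSqrtCoeff
  rw [← mul_div_assoc, h, pow_succ]
  field_simp
  ring

/-- The power series `(1 - wt)^(-1/2)`. -/
def invSqrtSeries (w : ℂ) : PowerSeries ℂ :=
  PowerSeries.mk fun n => (invSqrtCoeff n : ℂ) * w ^ n

lemma invSqrtSeries_derivative (w : ℂ) :
    2 * (1 - PowerSeries.C w * PowerSeries.X) * PowerSeries.derivative ℂ (invSqrtSeries w) =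
      PowerSeries.C w * invSqrtSeries w := by
  have h2 : (2 : PowerSeries ℂ) = PowerSeries.C 2 := (map_ofNat PowerSeries.C 2).symm
  rw [h2, mul_assoc, sub_mul, one_mul]
  have key : ∀ n : ℕ, ((n : ℂ) + 1) * (invSqrtCoeff (n + 1) : ℂ) =
      ((n : ℂ) + 1 / 2) * (invSqrtCoeff n : ℂ) := fun n => by
    simpa using congrArg ((↑) : ℝ → ℂ) (invSqrtCoeff_succ n)
  ext n
  rw [PowerSeries.coeff_C_mul, map_sub, mul_assoc, PowerSeries.coeff_C_mul,
    PowerSeries.coeff_C_mul, PowerSeries.coeff_derivative]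
  cases n with
  | zero =>
    have := key 0
    simp only [invSqrtSeries, PowerSeries.coeff_mk, PowerSeries.coeff_zero_X_mul]
    push_cast at this ⊢
    linear_combination 2 * w * this
  | succ n =>
    have := key (n + 1)
    rw [PowerSeries.coeff_succ_X_mul, PowerSeries.coeff_derivative]
    simp only [invSqrtSeries, PowerSeries.coeff_mk]
    push_cast at this ⊢
    linear_combination 2 * w ^ (n + 2) * this

/-- Convolution form of the zonal functions: `cos θ = (z + w) / 2` for `z = e^{iθ} = w⁻¹`. -/
def zonal (z w : ℂ) (n : ℕ) : ℂ :=
  ∑ p ∈ Finset.HasAntidiagonal.antidiagonal n,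
    ((invSqrtCoeff p.1 : ℂ) * z ^ p.1) * ((invSqrtCoeff p.2 : ℂ) * w ^ p.2)

lemma zonal_add_two {z w : ℂ} (hzw : z * w = 1) (n : ℕ) :
    (n + 2) * zonal z w (n + 2) =
      (2 * n + 3) * ((z + w) / 2) * zonal z w (n + 1) - (n + 1) * zonal z w n := by
  set f := invSqrtSeries z * invSqrtSeries w with hf
  have hc : ∀ m, PowerSeries.coeff m f = zonal z w m := fun m => by
    simp [hf, PowerSeries.coeff_mul, zonal, invSqrtSeries]
  have hC : PowerSeries.C z * PowerSeries.C w = (1 : PowerSeries ℂ) := by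
    rw [← map_mul, hzw, map_one]
  have hD : PowerSeries.C 2 * PowerSeries.derivative ℂ f
        - PowerSeries.C (2 * (z + w)) * (PowerSeries.X * PowerSeries.derivative ℂ f)
        + PowerSeries.C 2 * (PowerSeries.X * (PowerSeries.X * PowerSeries.derivative ℂ f)) =
      PowerSeries.C (z + w) * f - PowerSeries.C 2 * (PowerSeries.X * f) := by
    have h2 : PowerSeries.C (2 : ℂ) = 2 := map_ofNat PowerSeries.C 2
    have hz := invSqrtSeries_derivative z
    have hw := invSqrtSeries_derivative w
    rw [hf, Derivation.leibniz, map_mul, map_add, h2, smul_eq_mul, smul_eq_mul]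
    linear_combination (1 - PowerSeries.C z * PowerSeries.X) * invSqrtSeries z * hw +
      (1 - PowerSeries.C w * PowerSeries.X) * invSqrtSeries w * hz +
      (-2 * PowerSeries.X ^ 2 * (invSqrtSeries z * PowerSeries.derivative ℂ (invSqrtSeries w) +
        invSqrtSeries w * PowerSeries.derivative ℂ (invSqrtSeries z)) -
        2 * PowerSeries.X * invSqrtSeries z * invSqrtSeries w) * hC
  have h := congrArg (PowerSeries.coeff (n + 1)) hD
  simp only [map_sub, map_add (PowerSeries.coeff _), PowerSeries.coeff_C_mul,
    PowerSeries.coeff_succ_X_mul] at h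
  have h3 : PowerSeries.coeff n (PowerSeries.X * PowerSeries.derivative ℂ f) = n * zonal z w n := by
    cases n with
    | zero => simp
    | succ n =>
      rw [PowerSeries.coeff_succ_X_mul, PowerSeries.coeff_derivative, hc]
      push_cast
      ring
  rw [h3, PowerSeries.coeff_derivative, PowerSeries.coeff_derivative, hc, hc, hc] at h
  push_cast at h
  linear_combination h / 2

lemma legP_eq_zonal {x : ℝ} {z w : ℂ} (hzw : z * w = 1) (hx : z + w = 2 * x) (n : ℕ) :
    (legP n x : ℂ) = zonal z w n := by
  have h0 : invSqrtCoeff 0 = 1 := by simp [invSqrtCoeff]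
  have h1 : invSqrtCoeff 1 = 1 / 2 := by norm_num [invSqrtCoeff, Nat.centralBinom]
  induction n using Nat.twoStepInduction with
  | zero => simp [legP, zonal, h0]
  | one =>
    have : legP 1 x = x := by
      simp [legP]
    rw [this]
    simp [zonal, Finset.Nat.antidiagonal_succ, h0, h1]
    linear_combination -hx / 2
  | more n ih0 ih1 =>
    have h := congrArg ((↑) : ℝ → ℂ) (legP_add_two n x)
    push_cast at h
    have h' := zonal_add_two hzw n
    rw [← ih0, ← ih1, hx] at h'
    have hn : ((n : ℂ) + 2) ≠ 0 := by exact_mod_cast (by omega : n + 2 ≠ 0)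
    apply mul_left_cancel₀ hn
    rw [h, h']
    ring

open fwdDiff

lemma abs_fwdDiff_iter_le_of_iteratedDeriv {h C : ℝ} (hh : 0 ≤ h) {r : ℕ} {f : ℝ → ℝ}
    (hf : ContDiff ℝ r f) (hC : ∀ x, |iteratedDeriv r f x| ≤ C) (x : ℝ) :
    |Δ_[h] ^[r] f x| ≤ C * h ^ r := by
  induction r generalizing f C with
  | zero => simpa using hC x
  | succ r ih =>
    have hshift : ContDiff ℝ (r + 1 : ℕ) fun y => f (y + h) := by fun_prop
    have hle : (r : WithTop ℕ∞) ≤ (r + 1 : ℕ) := by exact_mod_cast r.le_succ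
    rw [Function.iterate_succ_apply]
    refine (ih (f := Δ_[h] f) (C := C * h) ((hshift.sub hf).of_le hle) fun y => ?_).trans_eq
      (by ring)
    have hd : iteratedDeriv r (Δ_[h] f) y = iteratedDeriv r f (y + h) - iteratedDeriv r f y := by
      have : Δ_[h] f = (fun y => f (y + h)) - f := rfl
      rw [this, iteratedDeriv_sub (hshift.of_le hle).contDiffAt (hf.of_le hle).contDiffAt,
        iteratedDeriv_comp_add_const]
    have hdiff : Differentiable ℝ (iteratedDeriv r f) :=
      hf.differentiable_iteratedDeriv r (by exact_mod_cast r.lt_succ_self)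
    have := convex_univ.norm_image_sub_le_of_norm_deriv_le (f := iteratedDeriv r f) (C := C)
      (x := y) (y := y + h) (fun z _ => hdiff z)
      (fun z _ => by rw [← iteratedDeriv_succ]; exact hC z) trivial trivial
    rw [hd]
    simpa [abs_of_nonneg hh] using this

lemma fwdDiff_iter_comp_affine (f : ℝ → ℝ) (s y : ℝ) (r : ℕ) (m : ℤ) :
    Δ_[(1 : ℤ)] ^[r] (fun m : ℤ => f (s * m + y)) m = Δ_[s] ^[r] f (s * m + y) := by
  induction r generalizing m with
  | zero => rfl
  | succ r ih =>
    rw [Function.iterate_succ_apply', Function.iterate_succ_apply', fwdDiff, fwdDiff, ih, ih]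
    push_cast
    ring_nf

/-- The first `R` differences of `f` are controlled by powers of the scale `ρ` where `m > ℓ`. -/
def DiffBound (R : ℕ) (A ρ ℓ : ℝ) (f : ℤ → ℝ) : Prop :=
  ∀ r ≤ R, ∀ m : ℤ, ℓ < m → |Δ_[(1 : ℤ)] ^[r] f m| ≤ A * ρ ^ r

lemma exists_diffBound_of_contDiff {R : ℕ} {f : ℝ → ℝ} (hf : ContDiff ℝ R f)
    (hs : HasCompactSupport f) :
    ∃ A, 0 ≤ A ∧ ∀ s y ℓ : ℝ, 0 ≤ s → DiffBound R A s ℓ fun m => f (s * m + y) := by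
  have hb : ∀ r : ℕ, ∃ C, 0 ≤ C ∧ (r ≤ R → ∀ x, |iteratedDeriv r f x| ≤ C) := by
    intro r
    by_cases hr : r ≤ R
    · have hr' : (r : WithTop ℕ∞) ≤ R := by exact_mod_cast hr
      have hcs : HasCompactSupport (iteratedDeriv r f) := by
        refine (hs.iteratedFDeriv (𝕜 := ℝ) r).mono fun x hx => ?_
        contrapose! hx
        simp only [Function.mem_support, not_not] at hx ⊢
        simp [iteratedDeriv, hx]
      obtain ⟨C, hC⟩ := (hf.continuous_iteratedDeriv r hr').bounded_above_of_compact_support hcs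
      exact ⟨C, (norm_nonneg _).trans (hC 0), fun _ => hC⟩
    · exact ⟨0, le_rfl, fun h => absurd h hr⟩
  choose C hC0 hC using hb
  refine ⟨∑ r ∈ Finset.range (R + 1), C r, Finset.sum_nonneg fun r _ => hC0 r, ?_⟩
  intro s y ℓ hs r hr m _
  rw [fwdDiff_iter_comp_affine]
  refine abs_fwdDiff_iter_le_of_iteratedDeriv hs (hf.of_le (by exact_mod_cast hr))
    (fun x => (hC r hr x).trans ?_) _
  exact Finset.single_le_sum (fun r _ => hC0 r) (Finset.mem_range.2 (by omega))

lemma abs_fwdDiff_iter_mul_le {A A' ρ : ℝ} (hA : 0 ≤ A) (hA' : 0 ≤ A') (hρ : 0 ≤ ρ) {R : ℕ}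
    {ℓ : ℝ} {f g : ℤ → ℝ} (hf : ∀ ℓ', DiffBound R A ρ ℓ' f) (hf0 : ∀ m : ℤ, m ≤ ℓ → f m = 0)
    (hg : DiffBound R A' ρ ℓ g) (m : ℤ) :
    |Δ_[(1 : ℤ)] ^[R] (fun m => f m * g m) m| ≤ 2 ^ R * (A * A') * ρ ^ R := by
  induction R generalizing f g A A' ℓ m with
  | zero =>
    have h := hf (m - 1) 0 le_rfl m (by simp)
    by_cases hm : (m : ℝ) ≤ ℓ
    · simpa [hf0 m hm] using by positivity
    · have h' := hg 0 le_rfl m (not_le.1 hm)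
      simp only [Function.iterate_zero, id_eq, pow_zero, mul_one, one_mul, abs_mul] at h h' ⊢
      gcongr
  | succ R ih =>
    have hsplit : Δ_[(1 : ℤ)] (fun m => f m * g m) =
        (fun m => Δ_[(1 : ℤ)] f m * g (m + 1)) + fun m => f m * Δ_[(1 : ℤ)] g m := by
      ext m
      simp only [fwdDiff, Pi.add_apply]
      ring
    rw [Function.iterate_succ_apply, hsplit, fwdDiff_iter_add, Pi.add_apply]
    have hdiff : ∀ {B : ℝ} {ℓ' : ℝ} {u : ℤ → ℝ}, DiffBound (R + 1) B ρ ℓ' u →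
        DiffBound R (B * ρ) ρ ℓ' (Δ_[(1 : ℤ)] u) := by
      intro B ℓ' u hu r hr m hm
      rw [← Function.iterate_succ_apply]
      exact (hu (r + 1) (by omega) m hm).trans_eq (by ring)
    have h1 := ih (A := A * ρ) (A' := A') (ℓ := ℓ - 1) (f := Δ_[(1 : ℤ)] f)
      (g := fun m => g (m + 1)) (by positivity) hA'
      (fun ℓ' => hdiff (hf ℓ'))
      (fun m hm => by
        rw [fwdDiff, hf0 (m + 1) (by push_cast; linarith), hf0 m (by linarith), sub_zero])
      (fun r hr m hm => by
        rw [fwdDiff_iter_comp_add]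
        exact hg r (by omega) (m + 1) (by push_cast; linarith)) m
    have h2 := ih (A := A) (A' := A' * ρ) (ℓ := ℓ) (f := f) (g := Δ_[(1 : ℤ)] g) hA
      (by positivity) (fun ℓ' r hr m hm => hf ℓ' r (by omega) m hm) hf0 (hdiff hg) m
    calc _ ≤ _ := abs_add_le _ _
      _ ≤ 2 ^ R * (A * ρ * A') * ρ ^ R + 2 ^ R * (A * (A' * ρ)) * ρ ^ R := add_le_add h1 h2
      _ = _ := by ring

lemma DiffBound.mul {A A' ρ : ℝ} (hA : 0 ≤ A) (hA' : 0 ≤ A') (hρ : 0 ≤ ρ) {R : ℕ}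
    {ℓ : ℝ} {f g : ℤ → ℝ} (hf : ∀ ℓ', DiffBound R A ρ ℓ' f) (hf0 : ∀ m : ℤ, m ≤ ℓ → f m = 0)
    (hg : DiffBound R A' ρ ℓ g) (ℓ' : ℝ) :
    DiffBound R (2 ^ R * (A * A')) ρ ℓ' fun m => f m * g m := by
  intro r hr m _
  refine (abs_fwdDiff_iter_mul_le hA hA' hρ (fun ℓ' r' hr' => hf ℓ' r' (hr'.trans hr)) hf0
    (fun r' hr' => hg r' (hr'.trans hr)) m).trans ?_
  gcongr
  norm_num

lemma fwdDiff_iter_invSqrtCoeff (r n : ℕ) :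
    Δ_[(1 : ℤ)] ^[r] (fun m : ℤ => invSqrtCoeff m.toNat) n =
      (-1) ^ r * invSqrtCoeff n * ∏ i ∈ Finset.range r, ((i + 1 / 2 : ℝ) / (n + 1 + i)) := by
  induction r generalizing n with
  | zero => simp
  | succ r ih =>
    have hcast : ((n : ℤ) + 1) = ((n + 1 : ℕ) : ℤ) := by push_cast; rfl
    rw [Function.iterate_succ_apply', fwdDiff, hcast, ih, ih]
    have hc := invSqrtCoeff_succ n
    have hn : (n : ℝ) + 1 ≠ 0 := by positivity
    have hc' : invSqrtCoeff (n + 1) = (n + 1 / 2) * invSqrtCoeff n / (n + 1) := by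
      rw [eq_div_iff hn]
      linear_combination hc
    have hnr : (n : ℝ) + 1 + r ≠ 0 := by positivity
    have hprod : ∏ i ∈ Finset.range r, ((i + 1 / 2 : ℝ) / ((n + 1 : ℕ) + 1 + i)) =
        (∏ i ∈ Finset.range r, ((i + 1 / 2 : ℝ) / (n + 1 + i))) * ((n + 1) / (n + 1 + r)) := by
      clear ih
      induction r with
      | zero => simp [hn]
      | succ r ih =>
        have h1 : (n : ℝ) + 1 + r ≠ 0 := by positivity
        have h2 : (n : ℝ) + 1 + (r + 1) ≠ 0 := by positivity
        rw [Finset.prod_range_succ, Finset.prod_range_succ, ih h1]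
        push_cast
        rw [show (n : ℝ) + 1 + 1 + r = n + 1 + (r + 1) by ring]
        generalize ∏ i ∈ Finset.range r, ((i + 1 / 2 : ℝ) / (n + 1 + i)) = Q
        field_simp
    rw [hprod, hc', Finset.prod_range_succ]
    field_simp
    ring

lemma invSqrtCoeff_le (n : ℕ) : invSqrtCoeff n ≤ 1 / √(n + 1) := by
  have hsq : invSqrtCoeff n ^ 2 * (n + 1) ≤ 1 := by
    induction n with
    | zero => simp [invSqrtCoeff]
    | succ n ih =>
      have hn : (0 : ℝ) < n + 1 := by positivity
      have hc := invSqrtCoeff_succ n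
      have h : (n + 1) ^ 3 * (invSqrtCoeff (n + 1) ^ 2 * ((n + 1 : ℕ) + 1)) =
          ((n + 1 / 2) ^ 2 * (n + 2)) * (invSqrtCoeff n ^ 2 * (n + 1)) := by
        push_cast
        linear_combination (n + 1) * (n + 2) *
          ((n + 1) * invSqrtCoeff (n + 1) + (n + 1 / 2) * invSqrtCoeff n) * hc
      have h' : ((n : ℝ) + 1 / 2) ^ 2 * (n + 2) ≤ (n + 1) ^ 3 := by
        have : (0 : ℝ) ≤ n := n.cast_nonneg
        nlinarith
      have hfin : ((n : ℝ) + 1) ^ 3 * (invSqrtCoeff (n + 1) ^ 2 * ((n + 1 : ℕ) + 1)) ≤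
          (n + 1) ^ 3 * 1 := by
        rw [h]
        exact mul_le_mul h' ih (by positivity) (by positivity)
      exact le_of_mul_le_mul_left hfin (by positivity)
  rw [le_div_iff₀ (by positivity)]
  refine abs_le_of_sq_le_sq' ?_ zero_le_one |>.2
  rw [mul_pow, Real.sq_sqrt (by positivity)]
  linarith

lemma sum_invSqrtCoeff_le (L : ℕ) : ∑ k ∈ Finset.range L, invSqrtCoeff k ≤ 2 * √L := by
  induction L with
  | zero => simp
  | succ L ih =>
    rw [Finset.sum_range_succ]
    have h1 : √(L + 1 : ℝ) ^ 2 = L + 1 := Real.sq_sqrt (by positivity)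
    have h2 : √(L : ℝ) ^ 2 = L := Real.sq_sqrt (by positivity)
    have hpos : 0 < √(L + 1 : ℝ) := by positivity
    have hle : √(L : ℝ) ≤ √(L + 1 : ℝ) := Real.sqrt_le_sqrt (by linarith)
    have : 1 / √(L + 1 : ℝ) ≤ 2 * √(L + 1 : ℝ) - 2 * √(L : ℝ) := by
      rw [div_le_iff₀ hpos]
      nlinarith
    push_cast
    linarith [invSqrtCoeff_le L]

lemma diffBound_invSqrtCoeff {R : ℕ} {δ N : ℝ} (hδ : 0 < δ) (hδ1 : δ ≤ 1) (hN : 0 < N) :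
    DiffBound R (R.factorial * δ⁻¹ ^ R * (1 / √(δ * N))) N⁻¹ (δ * N)
      fun m => invSqrtCoeff m.toNat := by
  intro r hr m hm
  have hm0 : 0 ≤ m := by
    have : (0 : ℝ) < m := (by positivity : 0 < δ * N).trans hm
    exact_mod_cast this.le
  lift m to ℕ using hm0
  have hm' : δ * N < m := by exact_mod_cast hm
  rw [fwdDiff_iter_invSqrtCoeff, abs_mul, abs_mul, abs_pow, abs_neg, abs_one, one_pow, one_mul,
    abs_of_pos (invSqrtCoeff_pos m), Finset.abs_prod]
  have h1 : invSqrtCoeff m ≤ 1 / √(δ * N) := by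
    refine (invSqrtCoeff_le m).trans ?_
    gcongr
    linarith
  have h2 : ∏ i ∈ Finset.range r, |(i + 1 / 2 : ℝ) / (m + 1 + i)| ≤
      ∏ i ∈ Finset.range r, ((i + 1 : ℝ) * (δ * N)⁻¹) := by
    refine Finset.prod_le_prod (fun i _ => abs_nonneg _) fun i _ => ?_
    rw [abs_of_nonneg (by positivity), div_eq_mul_inv]
    have : δ * N ≤ m + 1 + i := by
      have : (0 : ℝ) ≤ i := i.cast_nonneg
      linarith
    gcongr
    norm_num
  have h3 : ∏ i ∈ Finset.range r, ((i + 1 : ℝ) * (δ * N)⁻¹) =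
      r.factorial * δ⁻¹ ^ r * N⁻¹ ^ r := by
    rw [Finset.prod_mul_distrib, Finset.prod_const, Finset.card_range, mul_inv, mul_pow,
      ← Finset.prod_range_add_one_eq_factorial]
    push_cast
    ring
  have h4 : (r.factorial : ℝ) ≤ R.factorial := by exact_mod_cast Nat.factorial_le hr
  have h5 : δ⁻¹ ^ r ≤ δ⁻¹ ^ R := pow_le_pow_right₀ ((one_le_inv₀ hδ).2 hδ1) hr
  calc _ ≤ (1 / √(δ * N)) * (r.factorial * δ⁻¹ ^ r * N⁻¹ ^ r) := by
        rw [← h3]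
        exact mul_le_mul h1 h2 (Finset.prod_nonneg fun i _ => abs_nonneg _) (by positivity)
    _ ≤ (1 / √(δ * N)) * (R.factorial * δ⁻¹ ^ R * N⁻¹ ^ r) := by gcongr
    _ = _ := by ring

lemma fwdDiff_support_finite {F : ℤ → ℝ} (hF : F.support.Finite) :
    (Δ_[(1 : ℤ)] F).support.Finite := by
  refine (hF.union (hF.preimage (f := fun m => m + 1) (add_left_injective 1).injOn)).subset
    fun m hm => ?_
  by_contra h
  simp only [Set.mem_union, Set.mem_preimage, Function.mem_support, not_or, not_not] at h
  exact hm (by simp [fwdDiff, h.1, h.2])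

lemma tsum_fwdDiff_iter_mul_zpow {F : ℤ → ℝ} (hF : F.support.Finite) {z : ℂ} (hz : z ≠ 0)
    (r : ℕ) :
    ∑' m, ((Δ_[(1 : ℤ)] ^[r] F m : ℝ) : ℂ) * z ^ m = (z⁻¹ - 1) ^ r * ∑' m, (F m : ℂ) * z ^ m := by
  induction r generalizing F with
  | zero => simp
  | succ r ih =>
    have hsum : Summable fun m => (F m : ℂ) * z ^ m :=
      summable_of_hasFiniteSupport <| hF.subset fun m hm h => hm (by simp [h])
    have hsum' : Summable fun m => (F (m + 1) : ℂ) * z ^ (m + 1) :=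
      (Equiv.addRight (1 : ℤ)).summable_iff (f := fun m => (F m : ℂ) * z ^ m) |>.2 hsum
    have hshift : ∑' m, (F (m + 1) : ℂ) * z ^ (m + 1) = ∑' m, (F m : ℂ) * z ^ m :=
      (Equiv.addRight (1 : ℤ)).tsum_eq fun m => (F m : ℂ) * z ^ m
    have hterm : ∀ m : ℤ, ((Δ_[(1 : ℤ)] F m : ℝ) : ℂ) * z ^ m =
        z⁻¹ * ((F (m + 1) : ℂ) * z ^ (m + 1)) - (F m : ℂ) * z ^ m := fun m => by
      rw [fwdDiff, zpow_add_one₀ hz]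
      push_cast
      field_simp
    rw [Function.iterate_succ_apply, ih (fwdDiff_support_finite hF)]
    simp_rw [hterm]
    rw [(hsum'.mul_left _).tsum_sub hsum, tsum_mul_left, hshift]
    ring

lemma fwdDiff_iter_eq_zero_of_le {F : ℤ → ℝ} {L : ℤ} (hF : ∀ m, L ≤ m → F m = 0) (r : ℕ) (m : ℤ)
    (hm : L ≤ m) : Δ_[(1 : ℤ)] ^[r] F m = 0 := by
  induction r generalizing m with
  | zero => exact hF m hm
  | succ r ih => rw [Function.iterate_succ_apply', fwdDiff, ih _ hm, ih _ (by omega), sub_zero]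

lemma fwdDiff_iter_eq_zero_of_lt {F : ℤ → ℝ} (hF : ∀ m < 0, F m = 0) (r : ℕ) (m : ℤ)
    (hm : m < -r) : Δ_[(1 : ℤ)] ^[r] F m = 0 := by
  induction r generalizing m with
  | zero => exact hF m (by simpa using hm)
  | succ r ih =>
    push_cast at hm
    rw [Function.iterate_succ_apply', fwdDiff, ih _ (by omega), ih _ (by omega), sub_zero]

/-- Iterated summation by parts against `zᵐ` on the unit circle. -/
lemma norm_sum_mul_pow_le {F : ℤ → ℝ} {L : ℕ} (hneg : ∀ m < 0, F m = 0)
    (hL : ∀ m, (L : ℤ) ≤ m → F m = 0) {z : ℂ} (hz : ‖z‖ = 1) {r : ℕ} {D : ℝ}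
    (hD : ∀ m, |Δ_[(1 : ℤ)] ^[r] F m| ≤ D) :
    ‖∑ m ∈ Finset.range L, (F m : ℂ) * z ^ m‖ * ‖z - 1‖ ^ r ≤ (L + r) * D := by
  have hz0 : z ≠ 0 := norm_ne_zero_iff.1 (by rw [hz]; exact one_ne_zero)
  have hfin : F.support.Finite := by
    refine (Set.finite_Ico (0 : ℤ) L).subset fun m hm => ⟨?_, ?_⟩
    · by_contra h
      exact hm (hneg m (by omega))
    · by_contra h
      exact hm (hL m (by omega))
  have hsum : ∑' m, (F m : ℂ) * z ^ m = ∑ m ∈ Finset.range L, (F m : ℂ) * z ^ m := by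
    rw [tsum_eq_sum (s := (Finset.range L).map Nat.castEmbedding), Finset.sum_map]
    · simp
    · intro m hm
      have : F m = 0 := by
        by_cases h0 : m < 0
        · exact hneg m h0
        · refine hL m (not_lt.1 fun h => hm ?_)
          lift m to ℕ using not_lt.1 h0
          simpa using h
      simp [this]
  have hnorm : ‖z⁻¹ - 1‖ = ‖z - 1‖ := by
    have : z⁻¹ - 1 = -(z⁻¹ * (z - 1)) := by field_simp; ring
    rw [this, norm_neg, norm_mul, norm_inv, hz, inv_one, one_mul]
  have h := tsum_fwdDiff_iter_mul_zpow hfin hz0 r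
  rw [hsum, tsum_eq_sum (s := Finset.Ico (-(r : ℤ)) L)] at h
  · rw [mul_comm, ← hnorm, ← norm_pow, ← norm_mul, ← h]
    refine (norm_sum_le_of_le (f := fun m => ((Δ_[(1 : ℤ)] ^[r] F m : ℝ) : ℂ) * z ^ m) _
      (n := fun _ => D) fun m _ => ?_).trans_eq ?_
    · rw [norm_mul, norm_zpow, hz, one_zpow, mul_one, Complex.norm_real]
      exact hD m
    · rw [Finset.sum_const, Int.card_Ico, nsmul_eq_mul]
      congr 1
      have : ((L : ℤ) - -(r : ℤ)).toNat = L + r := by omega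
      rw [this]
      push_cast
      rfl
  · intro m hm
    rw [Finset.mem_Ico, not_and_or, not_le, not_lt] at hm
    rcases hm with hm | hm
    · rw [fwdDiff_iter_eq_zero_of_lt hneg r m hm]; simp
    · rw [fwdDiff_iter_eq_zero_of_le hL r m hm]; simp

/-- Localization of a smooth window against the Taylor coefficients of `(1 - z)^(-1/2)`. -/
lemma exists_norm_sum_invSqrtCoeff_le (R : ℕ) {δ K A : ℝ} (hδ : 0 < δ) (hδ1 : δ ≤ 1)
    (hK : 0 ≤ K) (hA : 0 ≤ A) :
    ∃ C, 0 ≤ C ∧ ∀ (N : ℝ), 1 ≤ N → ∀ φ : ℤ → ℝ, (∀ ℓ, DiffBound R A N⁻¹ ℓ φ) →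
      (∀ m : ℤ, m ≤ δ * N → φ m = 0) → (∀ m : ℤ, K * N ≤ m → φ m = 0) →
      ∀ L : ℕ, K * N ≤ L → L ≤ (K + 1) * N → ∀ z : ℂ, ‖z‖ = 1 → ∀ r ≤ R,
      ‖∑ m ∈ Finset.range L, (φ m : ℂ) * ((invSqrtCoeff m : ℂ) * z ^ m)‖ * (N * ‖z - 1‖) ^ r
        ≤ C * √N := by
  refine ⟨(K + 1 + R) * (2 ^ R * (A * (R.factorial * δ⁻¹ ^ R * (1 / √δ)))), by positivity, ?_⟩
  intro N hN φ hφ hφ0 hφ1 L hKL hL z hz r hr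
  have hN0 : 0 < N := one_pos.trans_le hN
  set A' : ℝ := R.factorial * δ⁻¹ ^ R * (1 / √(δ * N)) with hA'
  have hA'0 : 0 ≤ A' := by positivity
  have hD := abs_fwdDiff_iter_mul_le hA hA'0 (inv_nonneg.2 hN0.le) (R := r)
    (fun ℓ r' hr' => hφ ℓ r' (hr'.trans hr)) hφ0
    (fun r' hr' => diffBound_invSqrtCoeff hδ hδ1 hN0 r' (hr'.trans hr))
  have h := norm_sum_mul_pow_le (F := fun m => φ m * invSqrtCoeff m.toNat) (L := L)
    (fun m hm => by
      have : (m : ℝ) ≤ 0 := by exact_mod_cast hm.le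
      rw [hφ0 m (this.trans (by positivity)), zero_mul])
    (fun m hm => by
      have : (L : ℝ) ≤ m := by exact_mod_cast hm
      rw [hφ1 m (hKL.trans this), zero_mul]) hz hD
  have hsum : ∑ m ∈ Finset.range L, (φ m : ℂ) * ((invSqrtCoeff m : ℂ) * z ^ m) =
      ∑ m ∈ Finset.range L, ((φ m * invSqrtCoeff (m : ℤ).toNat : ℝ) : ℂ) * z ^ m :=
    Finset.sum_congr rfl fun m _ => by
      push_cast
      simp [mul_assoc]
  have hLr : (L + r : ℝ) ≤ (K + 1 + R) * N := by
    have h1 : (r : ℝ) ≤ R := by exact_mod_cast hr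
    have h2 : (R : ℝ) ≤ R * N := le_mul_of_one_le_right (by positivity) hN
    linarith
  have h2 : (2 : ℝ) ^ r ≤ 2 ^ R := pow_le_pow_right₀ (by norm_num) hr
  rw [hsum, mul_pow]
  calc _ = N ^ r * (‖∑ m ∈ Finset.range L,
          ((φ m * invSqrtCoeff (m : ℤ).toNat : ℝ) : ℂ) * z ^ m‖ * ‖z - 1‖ ^ r) := by ring
    _ ≤ N ^ r * ((L + r) * (2 ^ r * (A * A') * N⁻¹ ^ r)) := by gcongr
    _ = (L + r) * (2 ^ r * (A * A')) := by
        rw [inv_pow]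
        field_simp
    _ ≤ (K + 1 + R) * N * (2 ^ R * (A * A')) := by gcongr
    _ = _ := by
        have hs : √N * √N = N := Real.mul_self_sqrt hN0.le
        have hN' : √N ≠ 0 := by positivity
        have hδ' : √δ ≠ 0 := by positivity
        have : N * (1 / √(δ * N)) = 1 / √δ * √N := by
          rw [Real.sqrt_mul hδ.le]
          field_simp
          linarith
        rw [hA']
        linear_combination (K + 1 + R) * (2 ^ R * (A * (R.factorial * δ⁻¹ ^ R))) * this

lemma sum_range_sum_antidiagonal {L : ℕ} {f : ℕ × ℕ → ℂ} (hf : ∀ p, L ≤ p.1 + p.2 → f p = 0) :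
    ∑ n ∈ Finset.range L, ∑ p ∈ Finset.HasAntidiagonal.antidiagonal n, f p =
      ∑ k ∈ Finset.range L, ∑ m ∈ Finset.range L, f (k, m) := by
  rw [← Finset.sum_product', ← Finset.sum_filter_of_ne (p := fun p => p.1 + p.2 < L)
    (fun p _ hp => not_le.1 fun h => hp (hf p h)),
    ← Finset.sum_fiberwise_of_maps_to (t := Finset.range L) (g := fun p : ℕ × ℕ => p.1 + p.2)
    (fun p hp => Finset.mem_range.2 (Finset.mem_filter.1 hp).2)]
  refine Finset.sum_congr rfl fun n hn => Finset.sum_congr ?_ fun _ _ => rfl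
  ext p
  simp only [Finset.mem_range, Finset.HasAntidiagonal.mem_antidiagonal, Finset.mem_filter,
    Finset.mem_product] at hn ⊢
  omega

/-- A smooth cutoff with values in `[0, 1]` that is `1` on `[2ε, K]` and supported in `[ε, K + 1]`. -/
def cutoff (ε K x : ℝ) : ℝ :=
  Real.smoothTransition (x / ε - 1) * Real.smoothTransition (K + 1 - x)

lemma cutoff_contDiff (ε K : ℝ) (n : ℕ) : ContDiff ℝ n (cutoff ε K) :=
  (Real.smoothTransition.contDiff.comp (by fun_prop)).mul
    (Real.smoothTransition.contDiff.comp (by fun_prop))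

lemma cutoff_eq_zero {ε K x : ℝ} (hε : 0 < ε) (hx : x ≤ ε) : cutoff ε K x = 0 := by
  rw [cutoff, Real.smoothTransition.zero_of_nonpos, zero_mul]
  rw [sub_nonpos, div_le_one hε]
  exact hx

lemma cutoff_eq_one {ε K x : ℝ} (hε : 0 < ε) (hx : 2 * ε ≤ x) (hK : x ≤ K) :
    cutoff ε K x = 1 := by
  rw [cutoff, Real.smoothTransition.one_of_one_le, Real.smoothTransition.one_of_one_le, one_mul]
  · linarith
  · rw [le_sub_iff_add_le, le_div_iff₀ hε]
    linarith

lemma cutoff_hasCompactSupport {ε K : ℝ} (hε : 0 < ε) : HasCompactSupport (cutoff ε K) := by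
  refine HasCompactSupport.intro (isCompact_Icc (a := ε) (b := K + 1)) fun x hx => ?_
  rw [Set.mem_Icc, not_and_or, not_le, not_le] at hx
  rcases hx with hx | hx
  · exact cutoff_eq_zero hε hx.le
  · rw [cutoff, Real.smoothTransition.zero_of_nonpos (x := K + 1 - x) (by linarith), mul_zero]

lemma abs_one_sub_cutoff_le (ε K x : ℝ) : |1 - cutoff ε K x| ≤ 1 := by
  have h1 := mul_le_one₀ (Real.smoothTransition.le_one (x / ε - 1))
    (Real.smoothTransition.nonneg (K + 1 - x)) (Real.smoothTransition.le_one (K + 1 - x))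
  have h2 := mul_nonneg (Real.smoothTransition.nonneg (x / ε - 1))
    (Real.smoothTransition.nonneg (K + 1 - x))
  rw [cutoff, abs_le]
  constructor <;> linarith

/-- Localization of Legendre sums with a smooth window. -/
lemma exists_abs_sum_legP_le {R : ℕ} {β : ℝ → ℝ} (hβ : ContDiff ℝ R β) {δ K : ℝ} (hδ : 0 < δ)
    (hδ1 : δ ≤ 1) (hK : 0 ≤ K) (hβ0 : ∀ x ≤ δ, β x = 0) (hβ1 : ∀ x, K ≤ x → β x = 0) :
    ∃ C, 0 ≤ C ∧ ∀ N : ℝ, 1 ≤ N → ∀ L : ℕ, K * N ≤ L → L ≤ (K + 1) * N → ∀ θ : ℝ, ∀ r ≤ R,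
      |∑ n ∈ Finset.range L, β (n / N) * legP n (Real.cos θ)| *
        (N * ‖Complex.exp (Complex.I * θ) - 1‖) ^ r ≤ C * N := by
  have hβc : HasCompactSupport β := by
    refine HasCompactSupport.intro (isCompact_Icc (a := δ) (b := K)) fun x hx => ?_
    rw [Set.mem_Icc, not_and_or, not_le, not_le] at hx
    exact hx.elim (fun h => hβ0 x h.le) fun h => hβ1 x h.le
  have hε : 0 < δ / 4 := by positivity
  obtain ⟨A, hA, hAβ⟩ := exists_diffBound_of_contDiff hβ hβc
  obtain ⟨A', hA', hAχ⟩ := exists_diffBound_of_contDiff (cutoff_contDiff (δ / 4) K R)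
    (cutoff_hasCompactSupport hε)
  obtain ⟨C₁, hC₁, h₁⟩ := exists_norm_sum_invSqrtCoeff_le R (δ := δ / 4) (K := K)
    (A := 2 ^ R * (A' * A)) hε (by linarith) hK (by positivity)
  obtain ⟨C₂, hC₂, h₂⟩ := exists_norm_sum_invSqrtCoeff_le R (δ := δ / 4) (K := K)
    (A := A) hε (by linarith) hK hA
  refine ⟨2 * √(K + 1) * (C₁ + C₂), by positivity, ?_⟩
  intro N hN L hKL hL θ r hr
  have hN0 : 0 < N := one_pos.trans_le hN
  have hNi : 0 ≤ N⁻¹ := inv_nonneg.2 hN0.le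
  set z : ℂ := Complex.exp (Complex.I * θ) with hzdef
  have hz : ‖z‖ = 1 := Complex.norm_exp_I_mul_ofReal θ
  have hz0 : z ≠ 0 := Complex.exp_ne_zero _
  have hzw : z * z⁻¹ = 1 := mul_inv_cancel₀ hz0
  have hw : ‖z⁻¹‖ = 1 := by rw [norm_inv, hz, inv_one]
  have hw1 : ‖z⁻¹ - 1‖ = ‖z - 1‖ := by
    have : z⁻¹ - 1 = -(z⁻¹ * (z - 1)) := by field_simp; ring
    rw [this, norm_neg, norm_mul, hw, one_mul]
  have hcos : z + z⁻¹ = 2 * (Real.cos θ : ℝ) := by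
    rw [Complex.ofReal_cos, Complex.two_cos, hzdef, ← Complex.exp_neg]
    ring_nf
  set X : ℝ := (N * ‖z - 1‖) ^ r with hX
  have hX0 : 0 ≤ X := by positivity
  set u : ℕ → ℂ := fun k => (invSqrtCoeff k : ℂ) * z ^ k with hu
  set v : ℕ → ℂ := fun k => (invSqrtCoeff k : ℂ) * z⁻¹ ^ k with hv
  have hun : ∀ k, ‖u k‖ = invSqrtCoeff k := fun k => by
    simp [hu, hz, abs_of_pos (invSqrtCoeff_pos k)]
  have hvn : ∀ k, ‖v k‖ = invSqrtCoeff k := fun k => by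
    simp [hv, hz, abs_of_pos (invSqrtCoeff_pos k)]
  set χ := cutoff (δ / 4) K with hχ
  set φ₁ : ℕ → ℤ → ℝ := fun k m => χ (N⁻¹ * m + 0) * β (N⁻¹ * m + k / N) with hφ₁
  set φ₂ : ℕ → ℤ → ℝ := fun m k => β (N⁻¹ * k + m / N) with hφ₂
  have hS : ((∑ n ∈ Finset.range L, β (n / N) * legP n (Real.cos θ) : ℝ) : ℂ) =
      ∑ k ∈ Finset.range L, u k * ∑ m ∈ Finset.range L, (φ₁ k m : ℂ) * v m +
      ∑ m ∈ Finset.range L, ((1 - χ (m / N) : ℝ) : ℂ) * v m *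
        ∑ k ∈ Finset.range L, (φ₂ m k : ℂ) * u k := by
    have hexp : ((∑ n ∈ Finset.range L, β (n / N) * legP n (Real.cos θ) : ℝ) : ℂ) =
        ∑ k ∈ Finset.range L, ∑ m ∈ Finset.range L,
          (β (((k + m : ℕ) : ℝ) / N) : ℂ) * (u k * v m) := by
      rw [← sum_range_sum_antidiagonal
        (f := fun p => (β (((p.1 + p.2 : ℕ) : ℝ) / N) : ℂ) * (u p.1 * v p.2))]
      · push_cast
        refine Finset.sum_congr rfl fun n _ => ?_
        rw [legP_eq_zonal hzw hcos, zonal, Finset.mul_sum]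
        refine Finset.sum_congr rfl fun p hp => ?_
        rw [← Finset.HasAntidiagonal.mem_antidiagonal.1 hp]
        push_cast
        rfl
      · intro p hp
        have : (L : ℝ) ≤ ((p.1 + p.2 : ℕ) : ℝ) := by exact_mod_cast hp
        rw [hβ1 _ (by rw [le_div_iff₀ hN0]; exact hKL.trans this)]
        simp
    rw [hexp]
    simp_rw [Finset.mul_sum]
    rw [Finset.sum_comm (f := fun m k : ℕ => ((1 - χ (m / N) : ℝ) : ℂ) * v m * ((φ₂ m k : ℂ) * u k)),
      ← Finset.sum_add_distrib]
    refine Finset.sum_congr rfl fun k _ => ?_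
    rw [← Finset.sum_add_distrib]
    refine Finset.sum_congr rfl fun m _ => ?_
    have e0 : N⁻¹ * ((m : ℤ) : ℝ) + 0 = m / N := by push_cast; ring
    have e1 : N⁻¹ * ((m : ℤ) : ℝ) + k / N = ((k + m : ℕ) : ℝ) / N := by push_cast; ring
    have e2 : N⁻¹ * ((k : ℤ) : ℝ) + m / N = ((k + m : ℕ) : ℝ) / N := by push_cast; ring
    simp only [hφ₁, hφ₂, e0, e1, e2]
    push_cast
    ring
  have hb₁ : ∀ k, ‖∑ m ∈ Finset.range L, (φ₁ k m : ℂ) * v m‖ * X ≤ C₁ * √N := by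
    intro k
    have hvan : ∀ m : ℤ, (m : ℝ) ≤ δ / 4 * N → χ (N⁻¹ * m + 0) = 0 := fun m hm => by
      refine cutoff_eq_zero hε ?_
      rw [add_zero, inv_mul_le_iff₀ hN0]
      linarith
    have := h₁ N hN (φ₁ k)
      (DiffBound.mul hA' hA hNi (fun ℓ => hAχ N⁻¹ 0 ℓ hNi) hvan (hAβ N⁻¹ (k / N) _ hNi))
      (fun m hm => by simp only [hφ₁]; rw [hvan m hm, zero_mul])
      (fun m hm => by
        have hk : 0 ≤ (k : ℝ) / N := by positivity
        have : K ≤ N⁻¹ * m := by rw [le_inv_mul_iff₀ hN0]; linarith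
        simp only [hφ₁]
        rw [hβ1 _ (by linarith), mul_zero]) L hKL hL z⁻¹ hw r hr
    rwa [hw1] at this
  have hb₂ : ∀ m : ℕ, ‖((1 - χ (m / N) : ℝ) : ℂ) * v m *
      ∑ k ∈ Finset.range L, (φ₂ m k : ℂ) * u k‖ * X ≤ invSqrtCoeff m * (C₂ * √N) := by
    intro m
    have hc : 0 ≤ invSqrtCoeff m * (C₂ * √N) :=
      mul_nonneg (invSqrtCoeff_pos m).le (by positivity)
    rcases lt_or_ge ((m : ℝ) / N) (δ / 2) with hm | hm
    · have hin := h₂ N hN (φ₂ m) (fun ℓ => hAβ N⁻¹ (m / N) ℓ hNi)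
        (fun k hk => by
          have : N⁻¹ * k ≤ δ / 4 := by rw [inv_mul_le_iff₀ hN0]; linarith
          exact hβ0 _ (by linarith))
        (fun k hk => by
          have hk' : 0 ≤ (m : ℝ) / N := by positivity
          have : K ≤ N⁻¹ * k := by rw [le_inv_mul_iff₀ hN0]; linarith
          exact hβ1 _ (by linarith)) L hKL hL z hz r hr
      rw [norm_mul, norm_mul, hvn, Complex.norm_real, Real.norm_eq_abs]
      have h1 := abs_one_sub_cutoff_le (δ / 4) K (m / N)
      calc _ = |1 - χ (m / N)| * (invSqrtCoeff m *
            (‖∑ k ∈ Finset.range L, (φ₂ m k : ℂ) * u k‖ * X)) := by ring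
        _ ≤ 1 * (invSqrtCoeff m * (C₂ * √N)) := by
          have := (invSqrtCoeff_pos m).le
          gcongr
        _ = _ := one_mul _
    · rcases le_or_gt ((m : ℝ) / N) K with hmK | hmK
      · rw [hχ, cutoff_eq_one hε (by linarith) hmK]
        simpa using hc
      · have : ∑ k ∈ Finset.range L, (φ₂ m k : ℂ) * u k = 0 := by
          refine Finset.sum_eq_zero fun k _ => ?_
          have hk : 0 ≤ N⁻¹ * ((k : ℤ) : ℝ) := by positivity
          simp only [hφ₂]
          rw [hβ1 _ (by linarith)]
          simp
        rw [this]
        simpa using hc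
  have hsq : √(L : ℝ) ≤ √(K + 1) * √N := by
    rw [← Real.sqrt_mul (by linarith)]
    exact Real.sqrt_le_sqrt hL
  have hss : √N * √N = N := Real.mul_self_sqrt hN0.le
  rw [← Real.norm_eq_abs, ← Complex.norm_real, hS]
  calc _ ≤ (∑ k ∈ Finset.range L, ‖u k * ∑ m ∈ Finset.range L, (φ₁ k m : ℂ) * v m‖ +
        ∑ m ∈ Finset.range L, ‖((1 - χ (m / N) : ℝ) : ℂ) * v m *
          ∑ k ∈ Finset.range L, (φ₂ m k : ℂ) * u k‖) * X := by
        gcongr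
        exact (norm_add_le _ _).trans (add_le_add (norm_sum_le _ _) (norm_sum_le _ _))
    _ ≤ ∑ k ∈ Finset.range L, invSqrtCoeff k * (C₁ * √N) +
        ∑ m ∈ Finset.range L, invSqrtCoeff m * (C₂ * √N) := by
        rw [add_mul, Finset.sum_mul, Finset.sum_mul]
        refine add_le_add (Finset.sum_le_sum fun k _ => ?_) (Finset.sum_le_sum fun m _ => hb₂ m)
        rw [norm_mul, hun, mul_assoc]
        exact mul_le_mul_of_nonneg_left (hb₁ k) (invSqrtCoeff_pos k).le
    _ = (∑ k ∈ Finset.range L, invSqrtCoeff k) * ((C₁ + C₂) * √N) := by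
        rw [← Finset.sum_mul, ← Finset.sum_mul]
        ring
    _ ≤ 2 * (√(K + 1) * √N) * ((C₁ + C₂) * √N) := by
        gcongr
        exact (sum_invSqrtCoeff_le L).trans (by gcongr)
    _ = _ := by linear_combination 2 * √(K + 1) * (C₁ + C₂) * hss

lemma le_two_mul_norm_exp_sub_one {θ : ℝ} (h0 : 0 ≤ θ) (hπ : θ ≤ π) :
    θ ≤ 2 * ‖Complex.exp (Complex.I * θ) - 1‖ := by
  rw [Complex.norm_exp_I_mul_ofReal_sub_one, Real.norm_eq_abs]
  have h := Real.mul_le_sin (x := θ / 2) (by linarith) (by linarith)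
  have h' : θ / 4 ≤ 2 / π * (θ / 2) := by
    rw [show 2 / π * (θ / 2) = θ / π by ring]
    exact div_le_div_of_nonneg_left h0 Real.pi_pos Real.pi_le_four
  refine le_trans ?_ (mul_le_mul_of_nonneg_left (le_abs_self _) zero_le_two)
  linarith

lemma IsWindow.bW_eq_zero_of_le {B : ℝ} {M : ℕ} {a : ℝ → ℝ} (h : IsWindow B M a) {x : ℝ}
    (hx : |x| ≤ B⁻¹) : bW B a x = 0 := by
  have hB : 0 < B := one_pos.trans h.oneLt
  rw [bW, h.oneOn x hx, h.oneOn (x / B), sub_self]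
  rw [abs_div, abs_of_pos hB]
  exact (div_le_self (abs_nonneg x) h.oneLt.le).trans hx

lemma IsWindow.bW_eq_zero_of_ge {B : ℝ} {M : ℕ} {a : ℝ → ℝ} (h : IsWindow B M a) {x : ℝ}
    (hx : B ^ 2 + 1 ≤ x) : bW B a x = 0 := by
  have hB : 1 < B := h.oneLt
  have hx0 : 0 < x := by nlinarith
  rw [bW, h.suppB x, h.suppB (x / B), sub_self]
  · rw [abs_of_pos (by positivity), lt_div_iff₀ (by linarith)]
    nlinarith
  · rw [abs_of_pos hx0]
    nlinarith

/-- The restriction of the window `b` to the positive half-line. -/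
def posWindow (B : ℝ) (a : ℝ → ℝ) (x : ℝ) : ℝ := bW B a x * Real.smoothTransition (B * x)

lemma IsWindow.posWindow_eq_zero_of_le {B : ℝ} {M : ℕ} {a : ℝ → ℝ} (h : IsWindow B M a) {x : ℝ}
    (hx : x ≤ B⁻¹) : posWindow B a x = 0 := by
  have hB : 0 < B := one_pos.trans h.oneLt
  rcases le_total x 0 with h0 | h0
  · rw [posWindow, Real.smoothTransition.zero_of_nonpos, mul_zero]
    exact mul_nonpos_of_nonneg_of_nonpos hB.le h0
  · rw [posWindow, h.bW_eq_zero_of_le (by rwa [abs_of_nonneg h0]), zero_mul]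

lemma IsWindow.posWindow_eq {B : ℝ} {M : ℕ} {a : ℝ → ℝ} (h : IsWindow B M a) {x : ℝ}
    (hx : 0 ≤ x) : posWindow B a x = bW B a x := by
  have hB : 0 < B := one_pos.trans h.oneLt
  rcases le_total x B⁻¹ with hx' | hx'
  · rw [h.posWindow_eq_zero_of_le hx', h.bW_eq_zero_of_le (by rwa [abs_of_nonneg hx])]
  · rw [posWindow, Real.smoothTransition.one_of_one_le, mul_one]
    rwa [inv_le_iff_one_le_mul₀' hB] at hx'

lemma IsWindow.contDiff_posWindow {B : ℝ} {M : ℕ} {a : ℝ → ℝ} (h : IsWindow B M a) :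
    ContDiff ℝ M (posWindow B a) :=
  ((h.smooth.comp (by fun_prop)).sub h.smooth).mul
    (Real.smoothTransition.contDiff.comp (by fun_prop))

lemma IsWindow.exists_abs_kernel_mul_le {B : ℝ} {M : ℕ} {a : ℝ → ℝ} (h : IsWindow B M a) :
    ∃ D, 0 ≤ D ∧ ∀ j : ℕ, ∀ θ : ℝ, ∀ r ≤ M,
      |∑' l : ℕ, bjl B a j l * legL l (Real.cos θ)| *
        (B ^ j * ‖Complex.exp (Complex.I * θ) - 1‖) ^ r ≤ D * B ^ (2 * j) := by
  have hB : 0 < B := one_pos.trans h.oneLt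
  have hδ1 : B⁻¹ ≤ 1 := inv_le_one_of_one_le₀ h.oneLt.le
  set K : ℝ := B ^ 2 + 1 with hKdef
  have hK : 0 ≤ K := by positivity
  have hge : ∀ x, K ≤ x → posWindow B a x = 0 := fun x hx => by
    rw [posWindow, h.bW_eq_zero_of_ge hx, zero_mul]
  obtain ⟨C₀, hC₀, h₀⟩ := exists_abs_sum_legP_le h.contDiff_posWindow (inv_pos.2 hB) hδ1 hK
    (fun x hx => h.posWindow_eq_zero_of_le hx) hge
  obtain ⟨C₁, hC₁, h₁⟩ := exists_abs_sum_legP_le (β := fun x => x * posWindow B a x)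
    (contDiff_id.mul h.contDiff_posWindow) (inv_pos.2 hB) hδ1 hK
    (fun x hx => by rw [h.posWindow_eq_zero_of_le hx, mul_zero])
    (fun x hx => by rw [hge x hx, mul_zero])
  refine ⟨2 * C₁ + C₀, by positivity, fun j θ r hr => ?_⟩
  set N : ℝ := B ^ j with hN
  have hN1 : 1 ≤ N := one_le_pow₀ h.oneLt.le
  have hN0 : 0 < N := one_pos.trans_le hN1
  set L : ℕ := ⌈K * N⌉₊ with hLdef
  have hKL : K * N ≤ L := Nat.le_ceil _
  have hL : (L : ℝ) ≤ (K + 1) * N := by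
    have := Nat.ceil_lt_add_one (a := K * N) (by positivity)
    rw [hLdef]
    linarith
  set X : ℝ := (N * ‖Complex.exp (Complex.I * θ) - 1‖) ^ r with hX
  have hX0 : 0 ≤ X := by positivity
  specialize h₀ N hN1 L hKL hL θ r hr
  specialize h₁ N hN1 L hKL hL θ r hr
  set S₀ := ∑ n ∈ Finset.range L, posWindow B a (n / N) * legP n (Real.cos θ) with hS₀
  set S₁ := ∑ n ∈ Finset.range L, (n / N * posWindow B a (n / N)) * legP n (Real.cos θ) with hS₁
  have hsum : ∑' l : ℕ, bjl B a j l * legL l (Real.cos θ) =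
      (4 * π)⁻¹ * (2 * N * S₁ + S₀) := by
    rw [tsum_eq_sum (s := Finset.range L)]
    · rw [hS₀, hS₁, Finset.mul_sum, ← Finset.sum_add_distrib, Finset.mul_sum]
      refine Finset.sum_congr rfl fun n _ => ?_
      rw [h.posWindow_eq (by positivity), bjl, legL]
      field_simp
      exact mul_comm _ _
    · intro l hl
      have : (L : ℝ) ≤ l := by simpa using hl
      rw [bjl, h.bW_eq_zero_of_ge, zero_mul]
      rw [le_div_iff₀ hN0]
      exact hKL.trans this
  have hpi : (4 * π)⁻¹ ≤ 1 := inv_le_one_of_one_le₀ (by linarith [Real.pi_gt_three])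
  have hNN : N ≤ N ^ 2 := le_self_pow₀ hN1 two_ne_zero
  rw [hsum, abs_mul, abs_of_pos (by positivity : 0 < (4 * π)⁻¹), mul_comm 2 j, pow_mul]
  calc _ ≤ 1 * (2 * N * |S₁| + |S₀|) * X := by
        gcongr
        refine (abs_add_le _ _).trans_eq ?_
        rw [abs_mul, abs_of_pos (by positivity : 0 < 2 * N)]
    _ = 2 * N * (|S₁| * X) + |S₀| * X := by ring
    _ ≤ 2 * N * (C₁ * N) + C₀ * N := by gcongr
    _ ≤ 2 * N * (C₁ * N) + C₀ * N ^ 2 := by gcongr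
    _ = _ := by ring

lemma IsWindow.exists_abs_kernel_le {B : ℝ} {M : ℕ} {a : ℝ → ℝ} (h : IsWindow B M a) :
    ∃ c : ℝ, 0 < c ∧ ∀ j : ℕ, ∀ θ ∈ Set.Icc (0 : ℝ) π,
      |∑' l : ℕ, bjl B a j l * legL l (Real.cos θ)|
        ≤ c * B ^ (2 * j) / (1 + B ^ j * θ) ^ M := by
  have hB : 0 < B := one_pos.trans h.oneLt
  obtain ⟨D, hD, hbound⟩ := h.exists_abs_kernel_mul_le
  refine ⟨2 ^ (M - 1) * (D + 2 ^ M * D) + 1, by positivity, fun j θ hθ => ?_⟩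
  have hθ0 : 0 ≤ θ := hθ.1
  have h₀ := hbound j θ 0 M.zero_le
  have h₁ := hbound j θ M le_rfl
  rw [pow_zero, mul_one] at h₀
  set S := |∑' l : ℕ, bjl B a j l * legL l (Real.cos θ)| with hS
  have hS0 : 0 ≤ S := abs_nonneg _
  set q := ‖Complex.exp (Complex.I * θ) - 1‖ with hq
  have hNθ : (B ^ j * θ) ^ M ≤ 2 ^ M * (B ^ j * q) ^ M := by
    rw [← mul_pow]
    refine pow_le_pow_left₀ (by positivity) ?_ M
    have := mul_le_mul_of_nonneg_left (le_two_mul_norm_exp_sub_one hθ0 hθ.2)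
      (pow_pos hB j).le
    linarith
  rw [le_div_iff₀ (by positivity)]
  calc S * (1 + B ^ j * θ) ^ M
      ≤ S * (2 ^ (M - 1) * (1 ^ M + (B ^ j * θ) ^ M)) := by
        gcongr
        exact add_pow_le zero_le_one (by positivity) M
    _ ≤ S * (2 ^ (M - 1) * (1 ^ M + 2 ^ M * (B ^ j * q) ^ M)) := by gcongr
    _ = 2 ^ (M - 1) * (S + 2 ^ M * (S * (B ^ j * q) ^ M)) := by
        rw [one_pow]
        ring
    _ ≤ 2 ^ (M - 1) * (D * B ^ (2 * j) + 2 ^ M * (D * B ^ (2 * j))) := by gcongr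
    _ ≤ (2 ^ (M - 1) * (D + 2 ^ M * D) + 1) * B ^ (2 * j) := by
        have : 0 < B ^ (2 * j) := by positivity
        linarith

/-- Proposition 5: localization of the needlet kernel and of the needlets. -/
theorem stmt_3 (B : ℝ) (M : ℕ) (a : ℝ → ℝ) (hwin : IsWindow B M a) :
    (∃ c : ℝ, 0 < c ∧ ∀ j : ℕ, ∀ θ ∈ Set.Icc (0 : ℝ) π,
        |∑' l : ℕ, bjl B a j l * legL l (Real.cos θ)|
          ≤ c * B ^ (2 * j) / (1 + B ^ j * θ) ^ M) ∧
    ∀ c₀ : ℝ, 0 < c₀ → ∃ c' : ℝ, 0 < c' ∧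
      ∀ (μ : MeasureTheory.Measure E3), IsSphereMeasure μ →
      ∀ (j N : ℕ) (ξ : Fin N → E3) (lam : Fin N → ℝ),
        IsPixelization μ c₀ (4 * B ^ (j + 1)) ξ lam →
        ∀ (k : Fin N) (x : E3), ‖x‖ = 1 →
          |Real.sqrt (lam k) * psiSum B a j ⟪x, ξ k⟫|
            ≤ c' * B ^ j / (1 + B ^ j * gd x (ξ k)) ^ M := by
  have hB : 0 < B := one_pos.trans hwin.oneLt
  obtain ⟨c, hc, hker⟩ := hwin.exists_abs_kernel_le
  refine ⟨⟨c, hc, hker⟩, fun c₀ hc₀ => ⟨√c₀ * c, by positivity, ?_⟩⟩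
  intro μ _ j N ξ lam hpix k x hx
  have hinner := abs_le.1 (abs_real_inner_le_norm x (ξ k))
  rw [hx, hpix.sphere k, one_mul] at hinner
  have hcos : Real.cos (gd x (ξ k)) = ⟪x, ξ k⟫ := Real.cos_arccos hinner.1 hinner.2
  have h := hker j (gd x (ξ k)) ⟨Real.arccos_nonneg _, Real.arccos_le_pi _⟩
  rw [hcos] at h
  have hgd : 0 ≤ gd x (ξ k) := Real.arccos_nonneg _
  have hNj : 0 < B ^ j := pow_pos hB j
  have hlam : √(lam k) ≤ √c₀ / B ^ j := by
    rw [← Real.sqrt_sq hNj.le, ← Real.sqrt_div hc₀.le]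
    refine Real.sqrt_le_sqrt ((hpix.w_high k).trans ?_)
    rw [← div_eq_mul_inv]
    have : B ^ j ≤ 4 * B ^ (j + 1) := by
      rw [pow_succ]
      nlinarith [hwin.oneLt]
    gcongr
  rw [abs_mul, abs_of_nonneg (Real.sqrt_nonneg _), psiSum]
  calc _ ≤ √c₀ / B ^ j * (c * B ^ (2 * j) / (1 + B ^ j * gd x (ξ k)) ^ M) := by gcongr
    _ = _ := by
        rw [two_mul, pow_add]
        field_simp
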